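/- Let V be a finite type, let s, d ∈ V with s ≠ d, let N ≥ 2, and let v_1, …, v_N ∈ V be pairwise distinct, with the conventions v_{N+1} = v_1 and v_0 = v_N. Let f : Set V → ℝ and f_k : Set V → ℝ for k = 1, …, N all be submodular, and assume f S = f_k S for every k and every S ⊆ V with ¬(v_k ∈ S ∧ v_{k+1} ∉ S). For k = 2, …, N let g_k : Set V → ℝ be submodular with f_{k−1} S = g_k S for every S with ¬(v_k ∈ S ∧ v_{k+1} ∉ S), and f_k S = g_k S for every S with ¬(v_{k−1} ∈ S ∧ v_k ∉ S). Fix k ∈ {1, …, N} and assume that the minimum of f over all s–d cuts is strictly greater than the minimum of f_j over all s–d cuts for every j ∈ {1, …, k}. Then there exists an s–d cut S' attaining the minimum of f_k over all s–d cuts such that v_1, …, v_k ∈ S' and v_{k+1} ∉ S'. -/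

import Mathlib

/-- A function `g : Set V → ℝ` is submodular if
`g S1 + g S2 ≥ g (S1 ∪ S2) + g (S1 ∩ S2)` for all `S1, S2 ⊆ V`. -/
def Submodular {V : Type*} (g : Set V → ℝ) : Prop :=
  ∀ S1 S2 : Set V, g (S1 ∪ S2) + g (S1 ∩ S2) ≤ g S1 + g S2

/-- The minimum of `f` over all `s`–`d` cuts, i.e. over all `S ⊆ V` with `s ∈ S` and
`d ∉ S`.  For `V` finite and `s ≠ d` this collection is finite and nonempty, so the
infimum below is attained and is the minimum. -/
noncomputable def cutMin {V : Type*} (s d : V) (f : Set V → ℝ) : ℝ :=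
  sInf (f '' {S : Set V | s ∈ S ∧ d ∉ S})

theorem cutMin_le {V : Type*} [Finite V] {s d : V} (f : Set V → ℝ) {S : Set V}
    (hs : s ∈ S) (hd : d ∉ S) : cutMin s d f ≤ f S :=
  csInf_le (Set.toFinite _).bddBelow ⟨S, ⟨hs, hd⟩, rfl⟩

theorem exists_eq_cutMin {V : Type*} [Finite V] {s d : V} (hsd : s ≠ d) (f : Set V → ℝ) :
    ∃ S : Set V, s ∈ S ∧ d ∉ S ∧ f S = cutMin s d f := by
  have hne : (f '' {S : Set V | s ∈ S ∧ d ∉ S}).Nonempty :=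
    ⟨f {s}, {s}, ⟨rfl, fun h => hsd h.symm⟩, rfl⟩
  obtain ⟨S, ⟨hs, hd⟩, hS⟩ := hne.csInf_mem (Set.toFinite _)
  exact ⟨S, hs, hd, hS⟩

/-- If `f` and `f'` agree on sets that the link `(a, b)` does not leave, and the min-cut of `f'`
is smaller than that of `f`, then the link leaves every minimizing cut of `f'`. -/
theorem mem_and_notMem_of_eq_cutMin {V : Type*} [Finite V] {s d a b : V} {f f' : Set V → ℝ}
    (hff' : ∀ S : Set V, ¬(a ∈ S ∧ b ∉ S) → f S = f' S)
    (hlt : cutMin s d f' < cutMin s d f) {S : Set V} (hs : s ∈ S) (hd : d ∉ S)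
    (hS : f' S = cutMin s d f') : a ∈ S ∧ b ∉ S := by
  by_contra h
  have := cutMin_le f hs hd
  rw [hff' S h, hS] at this
  exact this.not_gt hlt

/-- The union of minimizing cuts of `p` and `q` minimizes `q` when `p` and `q` agree with a
submodular `g` on the sets without, respectively with, the vertex `a`. -/
theorem union_eq_cutMin {V : Type*} [Finite V] {s d a : V} {p q g : Set V → ℝ}
    (hg : Submodular g) (hp : ∀ S : Set V, a ∉ S → p S = g S) (hq : ∀ S : Set V, a ∈ S → q S = g S)
    {A B : Set V} (hsA : s ∈ A) (hdA : d ∉ A) (hA : p A = cutMin s d p) (haA : a ∉ A)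
    (hsB : s ∈ B) (hdB : d ∉ B) (hB : q B = cutMin s d q) (haB : a ∈ B) :
    q (A ∪ B) = cutMin s d q := by
  have hunion : cutMin s d q ≤ q (A ∪ B) := cutMin_le q (Or.inl hsA) (by simp [hdA, hdB])
  have hinter : cutMin s d p ≤ p (A ∩ B) := cutMin_le p ⟨hsA, hsB⟩ fun h => hdA h.1
  have hsub := hg A B
  rw [← hp A haA, ← hq B haB, ← hp (A ∩ B) fun h => haA h.1, ← hq (A ∪ B) (Or.inr haB)] at hsub
  linarith


/-- In the setting of the cycle `v 1 → … → v N → v 1` (pairwise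
distinct, conventions `v (N+1) = v 1`, `v 0 = v N`), with `f` the cut function of `G`,
`fk k` that of `G` with link `(v k, v (k+1))` removed, and `g k` (for `2 ≤ k ≤ N`) that
of `G` with both links `(v (k-1), v k)` and `(v k, v (k+1))` removed: if the min-cut of
`f` is strictly greater than the min-cut of `fk j` for every `j ∈ {1, …, k}`, then
`fk k` has a minimizing `s`–`d` cut `S'` containing `v 1, …, v k` and not `v (k+1)`. -/
theorem mincut_cycle_induction_step {V : Type*} [Fintype V]
    (s d : V) (hsd : s ≠ d)
    (N : ℕ) (hN : 2 ≤ N) (v : ℕ → V)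
    (hinj : Set.InjOn v (Set.Icc 1 N))
    (hconv1 : v (N + 1) = v 1) (hconv0 : v 0 = v N)
    (f : Set V → ℝ) (fk : ℕ → Set V → ℝ)
    (hf : Submodular f)
    (hfk : ∀ k, 1 ≤ k → k ≤ N → Submodular (fk k))
    (hffk : ∀ k, 1 ≤ k → k ≤ N →
      ∀ S : Set V, ¬(v k ∈ S ∧ v (k + 1) ∉ S) → f S = fk k S)
    (g : ℕ → Set V → ℝ)
    (hg : ∀ k, 2 ≤ k → k ≤ N → Submodular (g k))
    (hg1 : ∀ k, 2 ≤ k → k ≤ N →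
      ∀ S : Set V, ¬(v k ∈ S ∧ v (k + 1) ∉ S) → fk (k - 1) S = g k S)
    (hg2 : ∀ k, 2 ≤ k → k ≤ N →
      ∀ S : Set V, ¬(v (k - 1) ∈ S ∧ v k ∉ S) → fk k S = g k S)
    (k : ℕ) (hk1 : 1 ≤ k) (hkN : k ≤ N)
    (hlt : ∀ j, 1 ≤ j → j ≤ k → cutMin s d (fk j) < cutMin s d f) :
    ∃ S' : Set V, s ∈ S' ∧ d ∉ S' ∧ fk k S' = cutMin s d (fk k) ∧
      (∀ j, 1 ≤ j → j ≤ k → v j ∈ S') ∧ v (k + 1) ∉ S' := by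
  induction k, hk1 using Nat.le_induction with
  | base =>
    obtain ⟨S, hs, hd, hS⟩ := exists_eq_cutMin hsd (fk 1)
    obtain ⟨h1, h2⟩ := mem_and_notMem_of_eq_cutMin (hffk 1 le_rfl hkN) (hlt 1 le_rfl le_rfl) hs hd hS
    refine ⟨S, hs, hd, hS, fun j hj1 hj2 => ?_, h2⟩
    rwa [le_antisymm hj2 hj1]
  | succ n hn ih =>
    obtain ⟨A, hsA, hdA, hA, hvA, hnA⟩ :=
      ih (by lia) fun j hj1 hj2 => hlt j hj1 (by lia)
    obtain ⟨B, hsB, hdB, hB⟩ := exists_eq_cutMin hsd (fk (n + 1))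
    have hlink {S : Set V} := mem_and_notMem_of_eq_cutMin (S := S)
      (hffk (n + 1) (by lia) hkN) (hlt (n + 1) (by lia) le_rfl)
    have hdU : d ∉ A ∪ B := by simp [hdA, hdB]
    have hU : fk (n + 1) (A ∪ B) = cutMin s d (fk (n + 1)) :=
      union_eq_cutMin (hg (n + 1) (by lia) hkN)
        (fun S h => hg1 (n + 1) (by lia) hkN S fun h' => h h'.1)
        (fun S h => hg2 (n + 1) (by lia) hkN S fun h' => h'.2 h)
        hsA hdA hA hnA hsB hdB hB (hlink hsB hdB hB).1
    obtain ⟨h1, h2⟩ := hlink (Or.inl hsA) hdU hU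
    refine ⟨A ∪ B, Or.inl hsA, hdU, hU, fun j hj1 hj2 => ?_, h2⟩
    rcases Nat.le_succ_iff.mp hj2 with h | rfl
    · exact Or.inl (hvA j hj1 h)
    · exact h1
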